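/- There exists a universal constant C > 0 such that for every weighted graph G = (V,E,w) and every subset K ⊆ V of size k ≥ 2, there exists a spanner H of G that contains the minimum spanning tree MST(G), has lightness Ψ(H) ≤ C, and satisfies d_H(u,v) ≤ C·log(k)·d_G(u,v) for every pair (u,v) ∈ K × V. -/

import Mathlib

open Finset

attribute [local instance] Classical.propDecidable

section Defs

variable {V : Type*} [Fintype V]

/-- Total weight of a (sub)graph: the sum of its edge weights. -/
noncomputable def wWeight (H : SimpleGraph V) (w : Sym2 V → ℝ) : ℝ :=
  ∑ e ∈ H.edgeSet.toFinite.toFinset, w e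

/-- Shortest-path distance in a weighted graph: infimum of walk weights. -/
noncomputable def wdist (G : SimpleGraph V) (w : Sym2 V → ℝ) (u v : V) : ℝ :=
  sInf {x : ℝ | ∃ p : G.Walk u v, x = (p.edges.map w).sum}

/-- `T` is a spanning tree of `G`. -/
def IsSpanningTree (G T : SimpleGraph V) : Prop :=
  T ≤ G ∧ T.IsTree

/-- Weight of a minimum spanning tree of `G`. -/
noncomputable def mstWeight (G : SimpleGraph V) (w : Sym2 V → ℝ) : ℝ :=
  sInf {x : ℝ | ∃ T : SimpleGraph V, IsSpanningTree G T ∧ x = wWeight T w}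

/-- `T` is a minimum spanning tree of `G`. -/
def IsMST (G : SimpleGraph V) (w : Sym2 V → ℝ) (T : SimpleGraph V) : Prop :=
  IsSpanningTree G T ∧ ∀ T' : SimpleGraph V, IsSpanningTree G T' → wWeight T w ≤ wWeight T' w

/-- A spanner of `G`: a connected spanning subgraph. -/
def IsSpanner (G H : SimpleGraph V) : Prop := H ≤ G ∧ H.Connected

/-- `G` together with `w` is a weighted graph: connected, positive pairwise-distinct
edge weights. -/
def IsWeightedGraph (G : SimpleGraph V) (w : Sym2 V → ℝ) : Prop :=
  G.Connected ∧ (∀ e ∈ G.edgeSet, 0 < w e) ∧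
    (∀ e ∈ G.edgeSet, ∀ e' ∈ G.edgeSet, e ≠ e' → w e ≠ w e')

/-- The ordered pairs of distinct vertices whose distortion in `H` is at most `t`. -/
noncomputable def goodPairs (G H : SimpleGraph V) (w : Sym2 V → ℝ) (t : ℝ) : Finset (V × V) :=
  Finset.univ.offDiag.filter (fun p => wdist H w p.1 p.2 ≤ t * wdist G w p.1 p.2)

/-- Scaling distortion `γ`: for every `ε ∈ (0,1)`, at least a `(1-ε)` fraction of the
pairs of distinct vertices have distortion at most `γ ε`.  (Counted over ordered pairs:
`n·(n-1) = 2·(n choose 2)`.) -/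
def HasScalingDistortion (G H : SimpleGraph V) (w : Sym2 V → ℝ) (γ : ℝ → ℝ) : Prop :=
  ∀ ε : ℝ, 0 < ε → ε < 1 →
    (1 - ε) * ((Fintype.card V : ℝ) * ((Fintype.card V : ℝ) - 1)) ≤
      ((goodPairs G H w (γ ε)).card : ℝ)

/-- The `ℓ_q`-distortion of the spanner `H` of `G`. -/
noncomputable def distq (G H : SimpleGraph V) (w : Sym2 V → ℝ) (q : ℝ) : ℝ :=
  ((∑ p ∈ (Finset.univ : Finset V).offDiag, (wdist H w p.1 p.2 / wdist G w p.1 p.2) ^ q) /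
    ((Fintype.card V : ℝ) * ((Fintype.card V : ℝ) - 1))) ^ (1 / q)

/-- `R(v,ε)`: the minimal radius `r` such that the ball `B(v,r)` contains at least `εn`
vertices. -/
noncomputable def Rgraph (G : SimpleGraph V) (w : Sym2 V → ℝ) (v : V) (ε : ℝ) : ℝ :=
  sInf {r : ℝ | 0 ≤ r ∧
    ε * (Fintype.card V : ℝ) ≤ ((Finset.univ.filter (fun u => wdist G w u v ≤ r)).card : ℝ)}

/-- Coarse scaling distortion `γ`: every pair of distinct vertices that are mutually
`ε/2`-far has distortion at most `γ ε`. -/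
def HasCoarseScalingDistortion (G H : SimpleGraph V) (w : Sym2 V → ℝ) (γ : ℝ → ℝ) : Prop :=
  ∀ ε : ℝ, 0 < ε → ε < 1 → ∀ u v : V, u ≠ v →
    Rgraph G w v (ε / 2) ≤ wdist G w u v → Rgraph G w u (ε / 2) ≤ wdist G w u v →
    wdist H w u v ≤ γ ε * wdist G w u v

end Defs

section WeightedWalks

variable {V : Type*}

/-- Total weight of a walk, counted with multiplicity. -/
noncomputable def wlen (w : Sym2 V → ℝ) {G : SimpleGraph V} {u v : V} (p : G.Walk u v) : ℝ :=
  (p.edges.map w).sum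

theorem wlen_nonneg {w : Sym2 V → ℝ} (hw : ∀ e, 0 ≤ w e) {G : SimpleGraph V} {u v : V}
    (p : G.Walk u v) : 0 ≤ wlen w p :=
  List.sum_nonneg fun x hx => by
    obtain ⟨e, -, rfl⟩ := List.mem_map.1 hx
    exact hw e

@[simp] theorem wlen_nil (w : Sym2 V → ℝ) {G : SimpleGraph V} {u : V} :
    wlen w (SimpleGraph.Walk.nil : G.Walk u u) = 0 := by simp [wlen]

@[simp] theorem wlen_cons (w : Sym2 V → ℝ) {G : SimpleGraph V} {u v x : V} (h : G.Adj u v)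
    (p : G.Walk v x) : wlen w (SimpleGraph.Walk.cons h p) = w s(u, v) + wlen w p := by
  simp [wlen]

theorem wlen_append (w : Sym2 V → ℝ) {G : SimpleGraph V} {u v x : V} (p : G.Walk u v)
    (q : G.Walk v x) : wlen w (p.append q) = wlen w p + wlen w q := by
  simp [wlen, SimpleGraph.Walk.edges_append]

theorem wlen_reverse (w : Sym2 V → ℝ) {G : SimpleGraph V} {u v : V} (p : G.Walk u v) :
    wlen w p.reverse = wlen w p := by
  simp [wlen, List.sum_reverse]

theorem wlen_mapLe (w : Sym2 V → ℝ) {G H : SimpleGraph V} (h : G ≤ H) {u v : V}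
    (p : G.Walk u v) : wlen w (p.mapLe h) = wlen w p := by
  simp [wlen]

theorem wlen_bypass_le {w : Sym2 V → ℝ} (hw : ∀ e, 0 ≤ w e) {G : SimpleGraph V} {u v : V}
    (p : G.Walk u v) : wlen w p.bypass ≤ wlen w p := by
  induction p with
  | nil => simp [SimpleGraph.Walk.bypass]
  | @cons x y z h p ih =>
    rw [SimpleGraph.Walk.bypass]
    split_ifs with hs
    · have h1 := congrArg (wlen w) (p.bypass.take_spec hs)
      rw [wlen_append] at h1
      have := wlen_nonneg hw (p.bypass.takeUntil _ hs)
      rw [wlen_cons]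
      linarith [hw s(x, y)]
    · simp only [wlen_cons]; linarith

theorem wdist_le_wlen {w : Sym2 V → ℝ} (hw : ∀ e, 0 ≤ w e) {G : SimpleGraph V} {u v : V}
    (p : G.Walk u v) : wdist G w u v ≤ wlen w p :=
  csInf_le ⟨0, by rintro x ⟨q, rfl⟩; exact wlen_nonneg hw q⟩ ⟨p, rfl⟩

theorem exists_wlen_eq_wdist [Fintype V] {w : Sym2 V → ℝ} (hw : ∀ e, 0 ≤ w e) {G : SimpleGraph V}
    {u v : V} (h : G.Reachable u v) : ∃ p : G.Walk u v, wlen w p = wdist G w u v := by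
  obtain ⟨p₀⟩ := h
  have : Nonempty (G.Path u v) := ⟨p₀.toPath⟩
  obtain ⟨p, hp⟩ := Finite.exists_min (fun p : G.Path u v => wlen w p.1)
  refine ⟨p.1, le_antisymm (le_csInf ⟨_, p₀, rfl⟩ ?_) (wdist_le_wlen hw _)⟩
  rintro x ⟨q, rfl⟩
  exact (hp q.toPath).trans (wlen_bypass_le hw q)

theorem wdist_nonneg {w : Sym2 V → ℝ} (hw : ∀ e, 0 ≤ w e) (G : SimpleGraph V) (u v : V) :
    0 ≤ wdist G w u v :=
  Real.sInf_nonneg (by rintro x ⟨q, rfl⟩; exact wlen_nonneg hw q)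

theorem wdist_self {w : Sym2 V → ℝ} (hw : ∀ e, 0 ≤ w e) (G : SimpleGraph V) (u : V) :
    wdist G w u u = 0 :=
  le_antisymm ((wdist_le_wlen hw SimpleGraph.Walk.nil).trans (by simp)) (wdist_nonneg hw G u u)

theorem wdist_comm (G : SimpleGraph V) (w : Sym2 V → ℝ) (u v : V) :
    wdist G w u v = wdist G w v u := by
  unfold wdist
  congr 1
  ext x
  constructor <;>
  · rintro ⟨p, rfl⟩
    exact ⟨p.reverse, (wlen_reverse w p).symm⟩

theorem wdist_triangle [Fintype V] {w : Sym2 V → ℝ} (hw : ∀ e, 0 ≤ w e) {G : SimpleGraph V}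
    (hG : G.Connected) (u v x : V) : wdist G w u x ≤ wdist G w u v + wdist G w v x := by
  obtain ⟨p, hp⟩ := exists_wlen_eq_wdist hw (hG.preconnected u v)
  obtain ⟨q, hq⟩ := exists_wlen_eq_wdist hw (hG.preconnected v x)
  rw [← hp, ← hq, ← wlen_append]
  exact wdist_le_wlen hw _

theorem wdist_le_of_adj {w : Sym2 V → ℝ} (hw : ∀ e, 0 ≤ w e) {G : SimpleGraph V} {u v : V}
    (h : G.Adj u v) : wdist G w u v ≤ w s(u, v) :=
  (wdist_le_wlen hw (SimpleGraph.Walk.cons h SimpleGraph.Walk.nil)).trans (by simp)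

theorem wdist_anti [Fintype V] {w : Sym2 V → ℝ} (hw : ∀ e, 0 ≤ w e) {G H : SimpleGraph V}
    (hGH : G ≤ H) (hG : G.Connected) (u v : V) : wdist H w u v ≤ wdist G w u v := by
  obtain ⟨p, hp⟩ := exists_wlen_eq_wdist hw (hG.preconnected u v)
  rw [← hp, ← wlen_mapLe w hGH]
  exact wdist_le_wlen hw _

theorem wdist_le_mul_of_forall_adj [Fintype V] {w : Sym2 V → ℝ} (hw : ∀ e, 0 ≤ w e)
    {G H : SimpleGraph V} (hG : G.Connected) (hH : H.Connected) {t : ℝ}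
    (h : ∀ a b, G.Adj a b → wdist H w a b ≤ t * w s(a, b)) (u v : V) :
    wdist H w u v ≤ t * wdist G w u v := by
  obtain ⟨p, hp⟩ := exists_wlen_eq_wdist hw (hG.preconnected u v)
  rw [← hp]
  clear hp
  induction p with
  | nil => simp [wdist_self hw]
  | cons hadj p ih =>
    rw [wlen_cons, mul_add]
    exact (wdist_triangle hw hH _ _ _).trans (add_le_add (h _ _ hadj) ih)

theorem wdist_pos [Fintype V] {w : Sym2 V → ℝ} (hw : ∀ e, 0 ≤ w e) {G : SimpleGraph V}
    (hpos : ∀ e ∈ G.edgeSet, 0 < w e) (hG : G.Connected) {u v : V} (huv : u ≠ v) :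
    0 < wdist G w u v := by
  obtain ⟨p, hp⟩ := exists_wlen_eq_wdist hw (hG.preconnected u v)
  rw [← hp]
  cases p with
  | nil => exact absurd rfl huv
  | cons hadj p =>
    rw [wlen_cons]
    have := wlen_nonneg hw p
    have := hpos s(_, _) hadj
    linarith

/-- Distances after adding the single edge `ab` to a connected graph `H`. -/
theorem wdist_le_wlen_or_of_edge [Fintype V] {w : Sym2 V → ℝ} (hw : ∀ e, 0 ≤ w e)
    {H H' : SimpleGraph V} (hH : H.Connected) {a b : V}
    (h : ∀ x y, H'.Adj x y → s(x, y) ≠ s(a, b) → H.Adj x y) {x y : V} (p : H'.Walk x y) :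
    wdist H w x y ≤ wlen w p ∨
      wdist H w x a + w s(a, b) + wdist H w b y ≤ wlen w p ∨
      wdist H w x b + w s(a, b) + wdist H w a y ≤ wlen w p := by
  induction p with
  | nil => left; simp [wdist_self hw]
  | @cons x x' y hadj p ih =>
    rw [wlen_cons]
    have hwe := hw s(a, b)
    by_cases he : s(x, x') = s(a, b)
    · rw [he]
      rcases Sym2.eq_iff.1 he with ⟨rfl, rfl⟩ | ⟨rfl, rfl⟩
      · have h1 := wdist_self hw H x
        have h2 := wdist_nonneg hw H x' x
        have h3 := wdist_self hw H x'
        rcases ih with ih | ih | ih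
        · right; left; linarith
        · right; left; linarith
        · left; linarith
      · have h1 := wdist_self hw H x
        have h2 := wdist_nonneg hw H x' x
        have h3 := wdist_self hw H x'
        rcases ih with ih | ih | ih
        · right; right; linarith
        · left; linarith
        · right; right; linarith
    · have hd := wdist_le_of_adj hw (h x x' hadj he)
      have t1 := wdist_triangle hw hH x x' y
      have t2 := wdist_triangle hw hH x x' a
      have t3 := wdist_triangle hw hH x x' b
      rcases ih with ih | ih | ih
      · left; linarith
      · right; left; linarith
      · right; right; linarith

theorem wdist_le_or_of_edge [Fintype V] {w : Sym2 V → ℝ} (hw : ∀ e, 0 ≤ w e)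
    {H H' : SimpleGraph V} (hH : H.Connected) (hH' : H'.Connected) {a b : V}
    (h : ∀ x y, H'.Adj x y → s(x, y) ≠ s(a, b) → H.Adj x y) (x y : V) :
    wdist H w x y ≤ wdist H' w x y ∨
      wdist H w x a + w s(a, b) + wdist H w b y ≤ wdist H' w x y ∨
      wdist H w x b + w s(a, b) + wdist H w a y ≤ wdist H' w x y := by
  obtain ⟨p, hp⟩ := exists_wlen_eq_wdist hw (hH'.preconnected x y)
  rw [← hp]
  exact wdist_le_wlen_or_of_edge hw hH h p

end WeightedWalks

section RandomPartition

variable {V : Type*} [Fintype V]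

theorem sum_inv_card_filter_le_harmonic {V : Type*} (m : V → ℝ) (S : Finset V) :
    ∑ x ∈ S, ((S.filter fun y => m y ≤ m x).card : ℝ)⁻¹ ≤ (harmonic S.card : ℝ) := by
  induction S using Finset.induction_on_max_value m with
  | empty => simp
  | insert a S ha hmax ih =>
    rw [Finset.sum_insert ha, Finset.card_insert_of_notMem ha, harmonic_succ]
    push_cast
    have h1 : (insert a S).filter (fun y => m y ≤ m a) = insert a S := by
      apply Finset.filter_true_of_mem
      intro y hy
      rcases Finset.mem_insert.1 hy with rfl | hy
      · exact le_rfl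
      · exact hmax y hy
    rw [h1, Finset.card_insert_of_notMem ha]
    push_cast
    rw [add_comm]
    gcongr
    refine (Finset.sum_le_sum fun x hx => ?_).trans ih
    apply inv_anti₀
    · have : 0 < (S.filter fun y => m y ≤ m x).card :=
        Finset.card_pos.2 ⟨x, Finset.mem_filter.2 ⟨hx, le_rfl⟩⟩
      exact_mod_cast this
    · exact_mod_cast Finset.card_le_card
        (Finset.filter_subset_filter _ (Finset.subset_insert a S))

/-- In a uniformly random ordering, each element of `S` comes first with probability `1/|S|`. -/
theorem card_equiv_first_mul_card (S : Finset V) {x : V} (hx : x ∈ S) :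
    ((Finset.univ : Finset (V ≃ Fin (Fintype.card V))).filter
      fun π => ∀ y ∈ S, π x ≤ π y).card * S.card =
        Fintype.card (V ≃ Fin (Fintype.card V)) := by
  set N : V → ℕ := fun x => ((Finset.univ : Finset (V ≃ Fin (Fintype.card V))).filter
      fun π => ∀ y ∈ S, π x ≤ π y).card with hN
  have hswap : ∀ z ∈ S, N z = N x := by
    intro z hz
    refine Finset.card_equiv ((Equiv.swap x z).equivCongr (Equiv.refl _)) fun π => ?_
    simp only [Finset.mem_filter, Finset.mem_univ, true_and, Equiv.equivCongr_apply_apply,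
      Equiv.symm_swap, Equiv.refl_apply, Equiv.swap_apply_left]
    have hmem : ∀ y ∈ S, Equiv.swap x z y ∈ S := by
      intro y hy
      rw [Equiv.swap_apply_def]
      split_ifs <;> assumption
    constructor
    · exact fun h y hy => h _ (hmem y hy)
    · intro h y hy
      simpa using h _ (hmem y hy)
  have hsum : ∑ z ∈ S, N z = Fintype.card (V ≃ Fin (Fintype.card V)) := by
    simp only [hN, Finset.card_filter]
    rw [Finset.sum_comm (s := S)]
    refine (Finset.sum_congr rfl fun π _ => ?_).trans (Finset.card_eq_sum_ones Finset.univ).symm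
    obtain ⟨z, hz, hmin⟩ := S.exists_min_image π ⟨x, hx⟩
    rw [Finset.sum_eq_single_of_mem z hz, if_pos hmin]
    intro y hy hyz
    rw [if_neg]
    exact fun h => hyz (π.injective (le_antisymm (h z hz) (hmin y hy)))
  rw [← hsum, Finset.sum_congr rfl hswap, Finset.sum_const, smul_eq_mul, mul_comm]

open MeasureTheory in
/-- Averaging over a uniform radius: some radius is covered by at most the average weight
of a finite family of half-open intervals. -/
theorem exists_radius_sum_le {κ : Type*} (J : Finset κ) (A m M B : κ → ℝ) {α β : ℝ}
    (hαβ : α < β) (hA : ∀ j ∈ J, 0 ≤ A j) (hB : ∀ j ∈ J, 0 ≤ B j)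
    (hlen : ∀ j ∈ J, m j ≤ β → α < M j → M j - m j ≤ B j) :
    ∃ r ∈ Set.Icc α β,
      ∑ j ∈ J, (if m j ≤ r ∧ r < M j then A j else 0) ≤ (β - α)⁻¹ * ∑ j ∈ J, A j * B j := by
  set f : ℝ → ℝ := fun r => ∑ j ∈ J, (Set.Ico (m j) (M j)).indicator (fun _ => A j) r with hf
  have hint : ∀ j, Integrable ((Set.Ico (m j) (M j)).indicator fun _ => A j)
      (volume.restrict (Set.Icc α β)) := fun j =>
    (integrable_const (A j)).indicator measurableSet_Ico
  obtain ⟨r, hr, hle⟩ := exists_le_setAverage (μ := volume) (s := Set.Icc α β) (f := f)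
    (by simpa using hαβ) (by simp) (by
      change Integrable f _
      exact integrable_finsetSum _ fun j _ => hint j)
  refine ⟨r, hr, ?_⟩
  have hfr : f r = ∑ j ∈ J, (if m j ≤ r ∧ r < M j then A j else 0) := by
    simp only [hf, Set.indicator_apply, Set.mem_Ico]
  rw [← hfr]
  refine hle.trans ?_
  rw [setAverage_eq, smul_eq_mul, Measure.real, Real.volume_Icc,
    ENNReal.toReal_ofReal (sub_nonneg.2 hαβ.le)]
  have : 0 < β - α := sub_pos.2 hαβ
  gcongr
  rw [hf, integral_finsetSum _ fun j _ => hint j]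
  refine Finset.sum_le_sum fun j hj => ?_
  rw [integral_indicator_const _ measurableSet_Ico, smul_eq_mul, mul_comm]
  refine mul_le_mul_of_nonneg_left ?_ (hA j hj)
  rw [Measure.real, Measure.restrict_apply measurableSet_Ico]
  by_cases h : m j ≤ β ∧ α < M j
  · by_cases hmM : m j ≤ M j
    · refine (ENNReal.toReal_mono (by simp) (measure_mono Set.inter_subset_left)).trans ?_
      rw [Real.volume_Ico, ENNReal.toReal_ofReal (sub_nonneg.2 hmM)]
      exact hlen j hj h.1 h.2
    · rw [Set.Ico_eq_empty (fun h' => hmM h'.le)]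
      simpa using hB j hj
  · rw [show Set.Ico (m j) (M j) ∩ Set.Icc α β = ∅ from ?_]
    · simpa using hB j hj
    · ext r
      simp only [Set.mem_inter_iff, Set.mem_Ico, Set.mem_Icc, Set.mem_empty_iff_false, iff_false]
      rintro ⟨⟨h1, h2⟩, h3, h4⟩
      exact h ⟨h1.trans h4, h3.trans_lt h2⟩

/-- For a fixed radius, some ordering of the centers separates few pairs. -/
theorem exists_labeling_of_radius {ι : Type*} {ρ : V → V → ℝ} (hself : ∀ x, ρ x x = 0)
    (hcomm : ∀ x y, ρ x y = ρ y x) (htri : ∀ x y z, ρ x z ≤ ρ x y + ρ y z) {r : ℝ} (hr : 0 ≤ r)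
    (F : Finset ι) (a b : ι → V) (m M : ι → V → ℝ)
    (hm : ∀ f x, m f x = min (ρ x (a f)) (ρ x (b f)))
    (hM : ∀ f x, M f x = max (ρ x (a f)) (ρ x (b f))) :
    ∃ c : V → V, (∀ x y, c x = c y → ρ x y ≤ 2 * r) ∧
      ((F.filter fun f => c (a f) ≠ c (b f)).card : ℝ) ≤
        ∑ f ∈ F, ∑ x : V, if m f x ≤ r ∧ r < M f x then
          ((Finset.univ.filter fun y => m f y ≤ m f x).card : ℝ)⁻¹ else 0 := by
  have hcenter : ∀ (π : V ≃ Fin (Fintype.card V)) (v : V),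
      ∃ x, ρ x v ≤ r ∧ ∀ y, ρ y v ≤ r → π x ≤ π y := by
    intro π v
    obtain ⟨x, hx, hmin⟩ := (Finset.univ.filter fun x => ρ x v ≤ r).exists_min_image π
      ⟨v, by simp [hself, hr]⟩
    refine ⟨x, (Finset.mem_filter.1 hx).2, fun y hy => hmin y (by simp [hy])⟩
  choose c hc hcmin using hcenter
  have hcut : ∀ (π : V ≃ Fin (Fintype.card V)) (f : ι), c π (a f) ≠ c π (b f) →
      ∃ x, (m f x ≤ r ∧ r < M f x) ∧
        ∀ y ∈ Finset.univ.filter (fun y => m f y ≤ m f x), π x ≤ π y := by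
    intro π f hne
    have key : ∀ u v : V, (π (c π u) < π (c π v)) →
        (∀ x, m f x = min (ρ x u) (ρ x v)) → (∀ x, M f x = max (ρ x u) (ρ x v)) →
        ∃ x, (m f x ≤ r ∧ r < M f x) ∧
          ∀ y ∈ Finset.univ.filter (fun y => m f y ≤ m f x), π x ≤ π y := by
      intro u v hlt hm' hM'
      have h1 : m f (c π u) ≤ r := by rw [hm']; exact (min_le_left _ _).trans (hc π u)
      refine ⟨c π u, ⟨h1, ?_⟩, ?_⟩
      · rw [hM', lt_max_iff]
        right
        by_contra! h
        exact absurd (hcmin π v _ h) (not_le.2 hlt)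
      · intro y hy
        have hy : m f y ≤ r := (Finset.mem_filter.1 hy).2.trans h1
        rw [hm', min_le_iff] at hy
        rcases hy with hy | hy
        · exact hcmin π u y hy
        · exact hlt.le.trans (hcmin π v y hy)
    rcases lt_or_gt_of_ne (fun h => hne (π.injective h)) with h | h
    · exact key _ _ h (hm f) (hM f)
    · exact key _ _ h (fun x => by rw [hm, min_comm]) (fun x => by rw [hM, max_comm])
  set R : ℝ := ∑ f ∈ F, ∑ x : V, if m f x ≤ r ∧ r < M f x then
          ((Finset.univ.filter fun y => m f y ≤ m f x).card : ℝ)⁻¹ else 0 with hR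
  obtain ⟨π, -, hπ⟩ : ∃ π ∈ (Finset.univ : Finset (V ≃ Fin (Fintype.card V))),
      ((F.filter fun f => c π (a f) ≠ c π (b f)).card : ℝ) ≤ R := by
    refine Finset.exists_le_of_sum_le ⟨Fintype.equivFin V, Finset.mem_univ _⟩ ?_
    have h1 : ∀ π : V ≃ Fin (Fintype.card V), ((F.filter fun f => c π (a f) ≠ c π (b f)).card : ℝ) ≤
        ∑ f ∈ F, ∑ x : V, if m f x ≤ r ∧ r < M f x then
          (if ∀ y ∈ Finset.univ.filter (fun y => m f y ≤ m f x), π x ≤ π y then (1 : ℝ) else 0)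
          else 0 := by
      intro π
      rw [Finset.card_filter]
      push_cast
      refine Finset.sum_le_sum fun f _ => ?_
      have hnn : ∀ x ∈ (Finset.univ : Finset V), (0 : ℝ) ≤ if m f x ≤ r ∧ r < M f x then
          (if ∀ y ∈ Finset.univ.filter (fun y => m f y ≤ m f x), π x ≤ π y then (1 : ℝ) else 0)
          else 0 := fun x _ => by split_ifs <;> norm_num
      split_ifs with h
      · obtain ⟨x, hx1, hx2⟩ := hcut π f h
        refine le_trans ?_ (Finset.single_le_sum hnn (Finset.mem_univ x))
        rw [if_pos hx1, if_pos hx2]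
      · exact Finset.sum_nonneg hnn
    refine (Finset.sum_le_sum fun π _ => h1 π).trans (le_of_eq ?_)
    rw [Finset.sum_comm, Finset.sum_const, hR, Finset.smul_sum]
    refine Finset.sum_congr rfl fun f _ => ?_
    rw [Finset.sum_comm, Finset.smul_sum]
    refine Finset.sum_congr rfl fun x _ => ?_
    split_ifs with h
    · have hx : x ∈ Finset.univ.filter (fun y => m f y ≤ m f x) := by simp
      have := card_equiv_first_mul_card _ hx
      have hpos : (0 : ℝ) < ((Finset.univ.filter fun y => m f y ≤ m f x).card : ℝ) := by
        exact_mod_cast Finset.card_pos.2 ⟨x, hx⟩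
      rw [Finset.sum_boole, nsmul_eq_mul, eq_mul_inv_iff_mul_eq₀ hpos.ne', Finset.card_univ]
      exact_mod_cast this
    · simp
  refine ⟨c π, fun x y hxy => ?_, hπ⟩
  have h1 := hc π x
  have h2 := hc π y
  rw [hcomm] at h1
  rw [← hxy] at h2
  linarith [htri x (c π x) y]

/-- Low-diameter decomposition with separation probabilities governed by local growth. -/
theorem exists_labeling {ι : Type*} {ρ : V → V → ℝ} (hself : ∀ x, ρ x x = 0)
    (hcomm : ∀ x y, ρ x y = ρ y x) (htri : ∀ x y z, ρ x z ≤ ρ x y + ρ y z) {D : ℝ} (hD : 0 < D)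
    (F : Finset ι) (a b : ι → V) (l : ι → ℝ) (hl : ∀ f ∈ F, ρ (a f) (b f) ≤ l f)
    (hl0 : ∀ f ∈ F, 0 ≤ l f) (hlD : ∀ f ∈ F, l f ≤ D / 8) (m : ι → V → ℝ)
    (hm : ∀ f x, m f x = min (ρ x (a f)) (ρ x (b f))) :
    ∃ c : V → V, (∀ x y, c x = c y → ρ x y ≤ D) ∧
      ((F.filter fun f => c (a f) ≠ c (b f)).card : ℝ) ≤
        ∑ f ∈ F, 4 * l f / D * ∑ x : V, if D / 8 ≤ m f x ∧ m f x ≤ D / 2 then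
          ((Finset.univ.filter fun y => m f y ≤ m f x).card : ℝ)⁻¹ else 0 := by
  set M : ι → V → ℝ := fun f x => max (ρ x (a f)) (ρ x (b f)) with hM
  set h : ι → V → ℝ := fun f x => ((Finset.univ.filter fun y => m f y ≤ m f x).card : ℝ)⁻¹
    with hh
  have hh0 : ∀ f x, 0 ≤ h f x := fun f x => by positivity
  have hMm : ∀ f ∈ F, ∀ x, M f x - m f x ≤ l f := by
    intro f hf x
    have h1 := htri x (a f) (b f)
    have h2 := htri x (b f) (a f)
    have h3 := hcomm (b f) (a f)
    have h4 := hl f hf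
    rw [hm]
    simp only [hM]
    rcases le_total (ρ x (a f)) (ρ x (b f)) with h | h
    · rw [max_eq_right h, min_eq_left h]; linarith
    · rw [max_eq_left h, min_eq_right h]; linarith
  obtain ⟨r, hr, hle⟩ := exists_radius_sum_le (F ×ˢ (Finset.univ : Finset V))
    (fun j => h j.1 j.2) (fun j => m j.1 j.2) (fun j => M j.1 j.2)
    (fun j => if D / 8 ≤ m j.1 j.2 ∧ m j.1 j.2 ≤ D / 2 then l j.1 else 0)
    (α := D / 4) (β := D / 2) (by linarith) (fun j _ => hh0 _ _)
    (fun j hj => by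
      split_ifs
      exacts [hl0 _ (Finset.mem_product.1 hj).1, le_rfl])
    (fun j hj h1 h2 => by
      have hj := (Finset.mem_product.1 hj).1
      have := hMm _ hj j.2
      have := hlD _ hj
      rw [if_pos ⟨by linarith, h1⟩]
      assumption)
  obtain ⟨c, hc, hcut⟩ := exists_labeling_of_radius hself hcomm htri
    (show 0 ≤ r by linarith [hr.1]) F a b m M hm (fun f x => rfl)
  refine ⟨c, fun x y hxy => (hc x y hxy).trans (by linarith [hr.2]), hcut.trans ?_⟩
  rw [Finset.sum_product, Finset.sum_product] at hle
  refine hle.trans (le_of_eq ?_)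
  rw [Finset.mul_sum]
  refine Finset.sum_congr rfl fun f _ => ?_
  rw [Finset.mul_sum, Finset.mul_sum]
  refine Finset.sum_congr rfl fun x _ => ?_
  dsimp only
  split_ifs
  · field_simp
    ring
  · simp

end RandomPartition

section Greedy

variable {V : Type*}

theorem deleteEdges_singleton_connected {T H : SimpleGraph V} (hT : T.Connected) (hTH : T ≤ H)
    {a b : V} (hab : ¬ T.Adj a b) : (H.deleteEdges {s(a, b)}).Connected := by
  refine hT.mono fun x y hxy => ?_
  rw [SimpleGraph.deleteEdges_adj]
  refine ⟨hTH hxy, fun h => hab ?_⟩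
  rw [Set.mem_singleton_iff] at h
  rwa [← SimpleGraph.mem_edgeSet, ← h]

/-- The greedy spanner above a connected graph `T`. -/
theorem exists_greedy [Fintype V] {w : Sym2 V → ℝ} (hw : ∀ e, 0 ≤ w e) {G T : SimpleGraph V}
    (hT : T.Connected) (hTG : T ≤ G) {t : ℝ} (ht : 1 ≤ t) :
    ∃ H : SimpleGraph V, T ≤ H ∧ H ≤ G ∧
      (∀ a b, G.Adj a b → wdist H w a b ≤ t * w s(a, b)) ∧
      ∀ a b, H.Adj a b → ¬ T.Adj a b →
        t * w s(a, b) < wdist (H.deleteEdges {s(a, b)}) w a b := by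
  have main : ∀ S : Finset (Sym2 V), (S : Set (Sym2 V)) ⊆ G.edgeSet →
      ∃ H : SimpleGraph V, T ≤ H ∧ H ≤ G ∧ H.edgeSet ⊆ T.edgeSet ∪ S ∧
        (∀ a b, s(a, b) ∈ S → wdist H w a b ≤ t * w s(a, b)) ∧
        ∀ a b, H.Adj a b → ¬ T.Adj a b →
          t * w s(a, b) < wdist (H.deleteEdges {s(a, b)}) w a b := by
    intro S
    induction S using Finset.induction_on_max_value w with
    | empty => exact fun _ => ⟨T, le_rfl, hTG, by simp, by simp, fun a b h h' => absurd h h'⟩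
    | insert e S he hmax ih =>
      intro hS
      rw [Finset.coe_insert, Set.insert_subset_iff] at hS
      obtain ⟨H, hTH, hHG, hHS, hstr, hgood⟩ := ih hS.2
      have hH := hT.mono hTH
      induction e using Sym2.ind with | _ a b =>
      by_cases hab : wdist H w a b ≤ t * w s(a, b)
      · refine ⟨H, hTH, hHG, hHS.trans (Set.union_subset_union_right _ (by simp)), ?_, hgood⟩
        intro c d hcd
        rcases Finset.mem_insert.1 hcd with hcd | hcd
        · rcases Sym2.eq_iff.1 hcd with ⟨rfl, rfl⟩ | ⟨rfl, rfl⟩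
          · exact hab
          · rw [wdist_comm, Sym2.eq_swap]; exact hab
        · exact hstr c d hcd
      · have hGab : G.Adj a b := hS.1
        have hle : H ≤ H ⊔ SimpleGraph.edge a b := le_sup_left
        have hH1 := hH.mono hle
        have hwe := hw s(a, b)
        have hadj : ∀ x y, (H ⊔ SimpleGraph.edge a b).Adj x y → s(x, y) ≠ s(a, b) →
            H.Adj x y := by
          intro x y hxy hne
          rcases hxy with hxy | hxy
          · exact hxy
          · rw [SimpleGraph.edge_adj] at hxy
            exact absurd (Sym2.eq_iff.2 hxy.1) hne
        have heH : s(a, b) ∉ H.edgeSet := fun h => by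
          have := wdist_le_of_adj hw (SimpleGraph.mem_edgeSet _ |>.1 h)
          exact hab (this.trans (by nlinarith))
        refine ⟨H ⊔ SimpleGraph.edge a b, hTH.trans hle, sup_le hHG ?_, ?_, ?_, ?_⟩
        · intro x y hxy
          rw [SimpleGraph.edge_adj] at hxy
          rcases hxy.1 with ⟨rfl, rfl⟩ | ⟨rfl, rfl⟩
          exacts [hGab, hGab.symm]
        · rintro f hf
          by_cases hfe : f = s(a, b)
          · right; simp [hfe]
          · induction f using Sym2.ind with | _ x y =>
            rcases hHS ((SimpleGraph.mem_edgeSet _).2 (hadj x y hf hfe)) with h | h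
            · exact Or.inl h
            · right; rw [Finset.coe_insert]; exact Or.inr h
        · intro c d hcd
          rcases Finset.mem_insert.1 hcd with hcd | hcd
          · have : (H ⊔ SimpleGraph.edge a b).Adj c d := by
              right
              rw [SimpleGraph.edge_adj]
              refine ⟨Sym2.eq_iff.1 hcd, ?_⟩
              rintro rfl
              rcases Sym2.eq_iff.1 hcd with ⟨rfl, h⟩ | ⟨h, rfl⟩
              · exact hGab.ne h
              · exact hGab.ne h
            have h1 := wdist_le_of_adj hw this
            have := hw s(c, d)
            nlinarith
          · exact (wdist_anti hw hle hH c d).trans (hstr c d hcd)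
        · intro c d hcd hcdT
          by_cases hce : s(c, d) = s(a, b)
          · have hle' : (H ⊔ SimpleGraph.edge a b).deleteEdges {s(c, d)} ≤ H := by
              intro x y hxy
              rw [SimpleGraph.deleteEdges_adj] at hxy
              exact hadj x y hxy.1 (fun h => hxy.2 (by rw [h, hce]; rfl))
            have h1 := wdist_anti hw hle'
              (deleteEdges_singleton_connected hT (hTH.trans hle) hcdT) c d
            refine lt_of_lt_of_le ?_ h1
            rw [not_le] at hab
            rcases Sym2.eq_iff.1 hce with ⟨rfl, rfl⟩ | ⟨rfl, rfl⟩
            · exact hab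
            · rw [wdist_comm, Sym2.eq_swap]; exact hab
          · have hHcd := hadj c d hcd hce
            have hwf : w s(c, d) ≤ w s(a, b) := by
              rcases hHS (show s(c, d) ∈ H.edgeSet from hHcd) with h | h
              · exact absurd h hcdT
              · exact hmax _ h
            have hlt := hgood c d hHcd hcdT
            have hcon := deleteEdges_singleton_connected hT hTH hcdT
            have hcon' := deleteEdges_singleton_connected hT (hTH.trans hle) hcdT
            have hanti : ∀ x y, wdist H w x y ≤ wdist (H.deleteEdges {s(c, d)}) w x y :=
              wdist_anti hw (SimpleGraph.deleteEdges_le _) hcon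
            have hdc := wdist_le_of_adj hw hHcd
            rw [not_le] at hab
            have hwcd := hw s(c, d)
            by_contra! hcontra
            rcases wdist_le_or_of_edge hw hcon hcon' (a := a) (b := b) (fun x y hxy hne => by
              rw [SimpleGraph.deleteEdges_adj] at hxy ⊢
              exact ⟨hadj x y hxy.1 hne, hxy.2⟩) c d with h | h | h
            · linarith
            · have t1 := wdist_triangle hw hH a c b
              have t2 := wdist_triangle hw hH c d b
              have h1 := hanti c a
              have h2 := hanti b d
              rw [wdist_comm H w c a] at h1
              rw [wdist_comm H w b d] at h2
              nlinarith
            · have t1 := wdist_triangle hw hH a d b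
              have t2 := wdist_triangle hw hH d c b
              have h1 := hanti c b
              have h2 := hanti a d
              rw [wdist_comm H w d c] at t2
              nlinarith
  obtain ⟨H, h1, h2, -, h3, h4⟩ := main G.edgeSet.toFinite.toFinset (by simp)
  exact ⟨H, h1, h2, fun a b hab => h3 a b (by simpa using hab), h4⟩

end Greedy

section LightSpanner

theorem sum_zpow_two_le (I : Finset ℤ) :
    ∀ n : ℤ, (∀ i ∈ I, i ≤ n) → ∑ i ∈ I, (2 : ℝ) ^ i ≤ 2 * 2 ^ n := by
  induction I using Finset.induction_on_max with
  | empty => intro n _; simp; positivity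
  | insert a I hlt ih =>
    intro n hn
    rw [Finset.sum_insert fun h => lt_irrefl a (hlt a h)]
    have h1 := ih (a - 1) fun i hi => Int.le_sub_one_of_lt (hlt i hi)
    have h2 : (2 : ℝ) ^ a ≤ 2 ^ n :=
      zpow_le_zpow_right₀ one_le_two (hn a (Finset.mem_insert_self a I))
    rw [zpow_sub_one₀ two_ne_zero] at h1
    linarith

theorem sum_zpow_two_lt_le (I : Finset ℤ) {B : ℝ} (hB : 0 ≤ B) :
    ∑ i ∈ I with (2 : ℝ) ^ i < B, (2 : ℝ) ^ i ≤ 2 * B := by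
  rcases (I.filter fun i => (2 : ℝ) ^ i < B).eq_empty_or_nonempty with h | h
  · rw [h]; simpa using hB
  · refine (sum_zpow_two_le _ (Finset.max' _ h) fun i hi => Finset.le_max' _ i hi).trans ?_
    have := (Finset.mem_filter.1 (Finset.max'_mem _ h)).2
    linarith

theorem card_scales_le (I : Finset ℤ) {s : ℝ} (hs : 0 < s) (m : ℝ) :
    (I.filter fun i => s * 2 ^ i / 8 ≤ m ∧ m ≤ s * 2 ^ i / 2).card ≤ 3 := by
  rcases (I.filter fun i : ℤ => s * 2 ^ i / 8 ≤ m ∧ m ≤ s * 2 ^ i / 2).eq_empty_or_nonempty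
    with h | h
  · rw [h]; simp
  · obtain ⟨j, hj, hmin⟩ := Finset.exists_min_image _ id h
    have hsub : (I.filter fun i : ℤ => s * 2 ^ i / 8 ≤ m ∧ m ≤ s * 2 ^ i / 2) ⊆
        Finset.Icc j (j + 2) := by
      intro i hi
      refine Finset.mem_Icc.2 ⟨hmin i hi, ?_⟩
      have h1 := (Finset.mem_filter.1 hi).2.1
      have h2 := (Finset.mem_filter.1 hj).2.2
      have h3 : s * (2 : ℝ) ^ i ≤ s * 2 ^ (j + 2) := by
        rw [zpow_add₀ two_ne_zero]
        norm_num
        linarith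
      exact (zpow_le_zpow_iff_right₀ one_lt_two).1 (le_of_mul_le_mul_left h3 hs)
    refine (Finset.card_le_card hsub).trans (by rw [Int.card_Icc]; omega)

theorem card_add_one_le_of_isAcyclic {V : Type*} [Fintype V] [Nonempty V] {Q : SimpleGraph V}
    (hQ : Q.IsAcyclic) (U : Finset (Sym2 V)) (hU : ∀ e ∈ U, e ∈ Q.edgeSet) :
    U.card + 1 ≤ Fintype.card V := by
  obtain ⟨F, hQF, -, hF⟩ :=
    SimpleGraph.connected_top.exists_isTree_le_of_le_of_isAcyclic (le_top (a := Q)) hQ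
  rw [← hF.card_edgeFinset]
  gcongr
  intro e he
  exact SimpleGraph.mem_edgeFinset.2 (SimpleGraph.edgeSet_mono hQF (hU e he))

/-- Short edges inside clusters of a greedy spanner form a forest. -/
theorem isAcyclic_of_clusters {V : Type*} [Fintype V] {w : Sym2 V → ℝ} (hw : ∀ e, 0 ≤ w e)
    {H T Q : SimpleGraph V} (hT : T.IsTree) (hTH : T ≤ H) {t D : ℝ}
    (hgood : ∀ a b, H.Adj a b → ¬ T.Adj a b →
      t * w s(a, b) < wdist (H.deleteEdges {s(a, b)}) w a b)
    (hQH : Q ≤ H) {c : V → V} (hc : ∀ x y, c x = c y → wdist H w x y ≤ D)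
    (hQc : ∀ a b, Q.Adj a b → c a = c b) (hQw : ∀ a b, Q.Adj a b → w s(a, b) ≤ D)
    (hQt : ∀ a b, Q.Adj a b → ¬ T.Adj a b → 3 * D ≤ t * w s(a, b)) : Q.IsAcyclic := by
  intro z p hp
  by_cases hall : ∀ e ∈ p.edges, e ∈ T.edgeSet
  · exact hT.isAcyclic _ (hp.transfer hall)
  · push Not at hall
    obtain ⟨e, hep, heT⟩ := hall
    have heQ := p.edges_subset_edgeSet hep
    revert hep
    apply SimpleGraph.IsBridge.notMem_edges_of_isCycle _ hp
    induction e using Sym2.ind with | _ u v =>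
    rw [SimpleGraph.mem_edgeSet] at heQ heT
    rw [SimpleGraph.isBridge_iff]
    rintro ⟨q⟩
    have hcon := deleteEdges_singleton_connected hT.connected hTH heT
    have hH := hT.connected.mono hTH
    have huv := (hQt u v heQ heT).trans_lt (hgood u v (hQH heQ) heT)
    have hD : 0 ≤ D := (hw _).trans (hQw u v heQ)
    obtain ⟨d, -, hd1, hd2⟩ := q.exists_boundary_dart
      {x | c x = c u ∧ wdist (H.deleteEdges {s(u, v)}) w u x ≤ D}
      ⟨rfl, by rw [wdist_self hw]; exact hD⟩ (fun h => by linarith [h.2])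
    obtain ⟨⟨a, b⟩, hab⟩ := d
    simp only [Set.mem_ofPred_eq, not_and, not_le] at hd1 hd2 hab
    have hab' := hab
    rw [SimpleGraph.deleteEdges_adj] at hab'
    have hcb : c b = c u := (hQc a b hab'.1).symm.trans hd1.1
    have hub := hd2 hcb
    have hrho := hc u b hcb.symm
    have habd := wdist_le_of_adj hw (G := H.deleteEdges {s(u, v)}) (u := a) (v := b)
      (by rw [SimpleGraph.deleteEdges_adj]; exact ⟨hQH hab'.1, hab'.2⟩)
    have hwab := hQw a b hab'.1
    have t1 := wdist_triangle hw hcon u a v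
    have t2 := wdist_triangle hw hcon a b v
    have hwuv := hw s(u, v)
    rcases wdist_le_or_of_edge hw hcon hH (a := u) (b := v) (fun x y hxy hne => by
      rw [SimpleGraph.deleteEdges_adj]
      exact ⟨hxy, hne⟩) u b with h | h | h
    · linarith
    · rw [wdist_self hw] at h
      rw [wdist_comm _ w b v] at t2
      linarith
    · have := wdist_nonneg hw (H.deleteEdges {s(u, v)}) u b
      linarith

/-- The number of non-tree edges of a greedy spanner at one scale. -/
theorem card_scale_le {V : Type*} [Fintype V] {w : Sym2 V → ℝ} (hw : ∀ e, 0 ≤ w e)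
    {H T : SimpleGraph V} (hT : T.IsTree) (hTH : T ≤ H) {t D : ℝ} (hD : 0 < D)
    (hgood : ∀ a b, H.Adj a b → ¬ T.Adj a b →
      t * w s(a, b) < wdist (H.deleteEdges {s(a, b)}) w a b)
    (m : Sym2 V → V → ℝ)
    (hm : ∀ f x, m f x = min (wdist H w x (Quot.out f).1) (wdist H w x (Quot.out f).2))
    (E TE : Finset (Sym2 V)) (hTE : ∀ e, e ∈ TE ↔ e ∈ T.edgeSet)
    (hE : ∀ e ∈ E, e ∈ H.edgeSet ∧ e ∉ T.edgeSet ∧ w e ≤ D / 8 ∧ 3 * D ≤ t * w e) :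
    (E.card : ℝ) ≤ (TE.filter fun f => D / 8 < w f).card +
      (∑ f ∈ E, 4 * w f / D * ∑ x : V, if D / 8 ≤ m f x ∧ m f x ≤ D / 2 then
          ((Finset.univ.filter fun y => m f y ≤ m f x).card : ℝ)⁻¹ else 0) +
      ∑ f ∈ TE with w f ≤ D / 8, 4 * w f / D * ∑ x : V, if D / 8 ≤ m f x ∧ m f x ≤ D / 2 then
          ((Finset.univ.filter fun y => m f y ≤ m f x).card : ℝ)⁻¹ else 0 := by
  have hH := hT.connected.mono hTH
  have hne : Nonempty V := hT.connected.nonempty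
  set L := TE.filter fun f => w f ≤ D / 8 with hL
  have hdisj : Disjoint E L := by
    rw [Finset.disjoint_left]
    intro e he he'
    exact (hE e he).2.1 ((hTE e).1 (Finset.mem_filter.1 he').1)
  have hout : ∀ f : Sym2 V, s((Quot.out f).1, (Quot.out f).2) = f := fun f => Quot.out_eq f
  have hF : ∀ f ∈ E ∪ L, f ∈ H.edgeSet ∧ w f ≤ D / 8 ∧ (f ∉ T.edgeSet → 3 * D ≤ t * w f) := by
    intro f hf
    rcases Finset.mem_union.1 hf with hf | hf
    · exact ⟨(hE f hf).1, (hE f hf).2.2.1, fun _ => (hE f hf).2.2.2⟩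
    · have := Finset.mem_filter.1 hf
      have hfT := (hTE f).1 this.1
      exact ⟨SimpleGraph.edgeSet_mono hTH hfT, this.2, fun h => absurd hfT h⟩
  obtain ⟨c, hc, hcut⟩ := exists_labeling (ρ := wdist H w) (wdist_self hw H) (wdist_comm H w)
    (wdist_triangle hw hH) hD (E ∪ L) (fun f => (Quot.out f).1) (fun f => (Quot.out f).2) w
    (fun f hf => by
      have := (hF f hf).1
      rw [← hout f, SimpleGraph.mem_edgeSet] at this
      simpa [hout f] using wdist_le_of_adj hw this)
    (fun f _ => hw f) (fun f hf => (hF f hf).2.1) m hm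
  rw [Finset.sum_union hdisj] at hcut
  set U := (E ∪ L).filter fun f => ¬ (c (Quot.out f).1 ≠ c (Quot.out f).2) with hU
  have hUH : ∀ a b, s(a, b) ∈ U → H.Adj a b := fun a b h =>
    (hF _ (Finset.mem_filter.1 h).1).1
  have hQ : (SimpleGraph.fromEdgeSet (U : Set (Sym2 V))).IsAcyclic := by
    refine isAcyclic_of_clusters hw hT hTH hgood (c := c) (D := D) ?_ hc ?_ ?_ ?_
    · intro a b hab
      rw [SimpleGraph.fromEdgeSet_adj] at hab
      exact hUH a b hab.1
    · intro a b hab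
      rw [SimpleGraph.fromEdgeSet_adj] at hab
      have h1 := not_not.1 (Finset.mem_filter.1 hab.1).2
      rcases Sym2.eq_iff.1 (hout s(a, b)) with ⟨h2, h3⟩ | ⟨h2, h3⟩
      · rwa [h2, h3] at h1
      · rw [h2, h3] at h1; exact h1.symm
    · intro a b hab
      rw [SimpleGraph.fromEdgeSet_adj] at hab
      linarith [(hF _ (Finset.mem_filter.1 hab.1).1).2.1]
    · intro a b hab
      rw [SimpleGraph.fromEdgeSet_adj] at hab
      exact (hF _ (Finset.mem_filter.1 hab.1).1).2.2
  have hUcard := card_add_one_le_of_isAcyclic hQ U (fun e he => by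
    rw [SimpleGraph.edgeSet_fromEdgeSet]
    exact ⟨he, fun h => SimpleGraph.not_isDiag_of_mem_edgeSet _
      (hF e (Finset.mem_filter.1 he).1).1 h⟩)
  have hTcard : TE.card + 1 = Fintype.card V := by
    rw [← hT.card_edgeFinset]
    congr 2
    ext e
    rw [hTE, SimpleGraph.mem_edgeFinset]
  have h1 : ((E ∪ L).filter fun f => c (Quot.out f).1 ≠ c (Quot.out f).2).card + U.card =
      E.card + L.card := by
    rw [← Finset.card_union_of_disjoint hdisj, Finset.card_filter_add_card_filter_not]
  have h2 : L.card + (TE.filter fun f => D / 8 < w f).card = TE.card := by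
    rw [← Finset.card_filter_add_card_filter_not (s := TE) (fun f => w f ≤ D / 8)]
    simp only [not_le, hL]
  have h3 : E.card ≤ (TE.filter fun f => D / 8 < w f).card +
      ((E ∪ L).filter fun f => c (Quot.out f).1 ≠ c (Quot.out f).2).card := by omega
  have h4 : (E.card : ℝ) ≤ (TE.filter fun f => D / 8 < w f).card +
      ((E ∪ L).filter fun f => c (Quot.out f).1 ≠ c (Quot.out f).2).card := by exact_mod_cast h3
  linarith

theorem int_log_bounds {x : ℝ} (hx : 0 < x) :
    (2 : ℝ) ^ Int.log 2 x ≤ x ∧ x ≤ 2 * 2 ^ Int.log 2 x := by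
  have h1 := Int.zpow_log_le_self (b := 2) one_lt_two hx
  have h2 := Int.lt_zpow_succ_log_self (b := 2) one_lt_two x
  push_cast at h1 h2
  rw [zpow_add_one₀ two_ne_zero] at h2
  exact ⟨h1, by linarith⟩

/-- Summing the per-scale counts over all scales. -/
theorem sum_le_of_scales {ι : Type*} (N TE : Finset ι) {w : ι → ℝ} (hw : ∀ e, 0 ≤ w e)
    (hpos : ∀ e ∈ N, 0 < w e) {s k : ℝ} (hk : 1 ≤ k) (hs : s = 16 * k) (W : ℤ → ι → ℝ)
    (hWsum : ∀ (I : Finset ℤ) f, ∑ i ∈ I, W i f ≤ 3 * k)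
    (hscale : ∀ i, ((N.filter fun e => Int.log 2 (w e) = i).card : ℝ) ≤
      2 * (TE.filter fun f => s * 2 ^ i / 8 < w f).card +
        2 * ∑ f ∈ TE, 4 * w f / (s * 2 ^ i) * W i f) :
    ∑ e ∈ N, w e ≤ 7 * ∑ f ∈ TE, w f := by
  have hs0 : 0 < s := by linarith
  set I := N.image (fun e => Int.log 2 (w e)) with hI
  calc ∑ e ∈ N, w e = ∑ i ∈ I, ∑ e ∈ N with Int.log 2 (w e) = i, w e :=
        (Finset.sum_fiberwise_of_maps_to
          (fun e he => Finset.mem_image_of_mem (fun e => Int.log 2 (w e)) he) w).symm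
    _ ≤ ∑ i ∈ I, ((N.filter fun e => Int.log 2 (w e) = i).card : ℝ) * (2 * 2 ^ i) := by
        refine Finset.sum_le_sum fun i _ => ?_
        rw [← nsmul_eq_mul]
        exact Finset.sum_le_card_nsmul _ _ _ fun e he => by
          obtain ⟨heN, rfl⟩ := Finset.mem_filter.1 he
          exact (int_log_bounds (hpos e heN)).2
    _ ≤ ∑ i ∈ I, ∑ f ∈ TE, (4 * (if (2 : ℝ) ^ i < 8 * w f / s then 2 ^ i else 0) +
          16 * w f / s * W i f) := by
        refine Finset.sum_le_sum fun i _ => ?_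
        have h2i : (0 : ℝ) < 2 ^ i := by positivity
        refine (mul_le_mul_of_nonneg_right (hscale i) (by positivity)).trans (le_of_eq ?_)
        rw [Finset.sum_add_distrib, add_mul, Finset.card_filter]
        push_cast
        rw [Finset.mul_sum, Finset.sum_mul, Finset.mul_sum, Finset.sum_mul]
        congr 1
        · refine Finset.sum_congr rfl fun f _ => ?_
          have : s * 2 ^ i / 8 < w f ↔ (2 : ℝ) ^ i < 8 * w f / s := by
            rw [div_lt_iff₀ (by norm_num), lt_div_iff₀ hs0, mul_comm s, mul_comm (w f)]
          simp only [this]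
          split_ifs <;> ring
        · refine Finset.sum_congr rfl fun f _ => ?_
          field_simp
          ring
    _ ≤ ∑ f ∈ TE, 7 * w f := by
        rw [Finset.sum_comm]
        refine Finset.sum_le_sum fun f _ => ?_
        rw [Finset.sum_add_distrib, ← Finset.mul_sum, ← Finset.mul_sum, ← Finset.sum_filter]
        have hwf := hw f
        have h1 := sum_zpow_two_lt_le I (B := 8 * w f / s) (by positivity)
        have h2 : 16 * w f / s * ∑ i ∈ I, W i f ≤ 16 * w f / s * (3 * k) :=
          mul_le_mul_of_nonneg_left (hWsum I f) (by positivity)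
        have h3 : 16 * w f / s * (3 * k) = 3 * w f := by
          rw [hs]; field_simp
        have h4 : 8 * w f / s ≤ w f / 2 := by
          rw [div_le_div_iff₀ hs0 two_pos, hs]
          nlinarith
        linarith
    _ = _ := by rw [Finset.mul_sum]

theorem mem_edges_toFinset {V : Type*} [Fintype V] {H : SimpleGraph V} {e : Sym2 V} :
    e ∈ H.edgeSet.toFinite.toFinset ↔ e ∈ H.edgeSet := by simp

/-- Above any spanning tree there is a spanner of constant lightness and logarithmic stretch. -/
theorem exists_light_spanner {V : Type*} [Fintype V] {w : Sym2 V → ℝ} (hw : ∀ e, 0 ≤ w e)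
    {G T : SimpleGraph V} (hpos : ∀ e ∈ G.edgeSet, 0 < w e) (hT : T.IsTree) (hTG : T ≤ G)
    {t : ℝ} (ht : 48 * (harmonic (Fintype.card V) : ℝ) ≤ t) :
    ∃ H : SimpleGraph V, T ≤ H ∧ H ≤ G ∧ wWeight H w ≤ 8 * wWeight T w ∧
      ∀ a b, G.Adj a b → wdist H w a b ≤ t * w s(a, b) := by
  have hne : Nonempty V := hT.connected.nonempty
  set k : ℝ := (harmonic (Fintype.card V) : ℝ) with hk
  have hk1 : 1 ≤ k := by
    have h1 : Fintype.card V ≠ 0 := Fintype.card_ne_zero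
    have h2 : (1 : ℚ) ≤ harmonic (Fintype.card V) := by
      unfold harmonic
      have := Finset.single_le_sum (f := fun i : ℕ => ((i + 1 : ℕ) : ℚ)⁻¹)
        (s := Finset.range (Fintype.card V)) (fun i _ => by positivity)
        (Finset.mem_range.2 (Nat.pos_of_ne_zero h1))
      simpa using this
    rw [hk]
    exact_mod_cast h2
  obtain ⟨H, hTH, hHG, hstr, hgood⟩ := exists_greedy hw hT.connected hTG
    (show 1 ≤ t by linarith)
  refine ⟨H, hTH, hHG, ?_, hstr⟩
  set s : ℝ := 16 * k with hs
  have hs0 : 0 < s := by linarith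
  set HE := H.edgeSet.toFinite.toFinset with hHE
  set TE := T.edgeSet.toFinite.toFinset with hTE
  set N := HE \ TE with hN
  have hNmem : ∀ e, e ∈ N ↔ e ∈ H.edgeSet ∧ e ∉ T.edgeSet := by
    intro e
    rw [hN, Finset.mem_sdiff, mem_edges_toFinset, mem_edges_toFinset]
  set E : ℤ → Finset (Sym2 V) := fun i => N.filter fun e => Int.log 2 (w e) = i with hEdef
  set m : Sym2 V → V → ℝ :=
    fun f x => min (wdist H w x (Quot.out f).1) (wdist H w x (Quot.out f).2) with hm
  set h : Sym2 V → V → ℝ :=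
    fun f x => ((Finset.univ.filter fun y => m f y ≤ m f x).card : ℝ)⁻¹ with hh
  have hh0 : ∀ f x, 0 ≤ h f x := fun f x => by positivity
  have hhk : ∀ f, ∑ x, h f x ≤ k := fun f =>
    sum_inv_card_filter_le_harmonic (m f) Finset.univ
  set W : ℤ → Sym2 V → ℝ := fun i f => ∑ x : V, if s * 2 ^ i / 8 ≤ m f x ∧
    m f x ≤ s * 2 ^ i / 2 then h f x else 0 with hW
  have hWk : ∀ i f, W i f ≤ k := fun i f => (Finset.sum_le_sum fun x _ => by
    split_ifs
    exacts [le_rfl, hh0 f x]).trans (hhk f)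
  have hW0 : ∀ i f, 0 ≤ W i f := fun i f => Finset.sum_nonneg fun x _ => by
    split_ifs
    exacts [hh0 f x, le_rfl]
  have hWsum : ∀ (I : Finset ℤ) f, ∑ i ∈ I, W i f ≤ 3 * k := by
    intro I f
    simp only [hW]
    rw [Finset.sum_comm]
    calc _ ≤ ∑ x, 3 * h f x := by
          refine Finset.sum_le_sum fun x _ => ?_
          rw [← Finset.sum_filter, Finset.sum_const, nsmul_eq_mul]
          refine mul_le_mul_of_nonneg_right ?_ (hh0 f x)
          exact_mod_cast card_scales_le I hs0 (m f x)
      _ ≤ _ := by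
          rw [← Finset.mul_sum]
          linarith [hhk f]
  have hNpos : ∀ e ∈ N, 0 < w e := fun e he =>
    hpos e (SimpleGraph.edgeSet_mono hHG ((hNmem e).1 he).1)
  have hElog : ∀ i, ∀ e ∈ E i, (2 : ℝ) ^ i ≤ w e ∧ w e ≤ 2 * 2 ^ i := by
    intro i e he
    obtain ⟨heN, rfl⟩ := Finset.mem_filter.1 he
    exact int_log_bounds (hNpos e heN)
  have hscale : ∀ i, ((E i).card : ℝ) ≤ 2 * (TE.filter fun f => s * 2 ^ i / 8 < w f).card +
      2 * ∑ f ∈ TE, 4 * w f / (s * 2 ^ i) * W i f := by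
    intro i
    have h2i : (0 : ℝ) < 2 ^ i := by positivity
    have hD : 0 < s * 2 ^ i := by positivity
    have key := card_scale_le hw hT hTH hD hgood m (fun f x => rfl) (E i) TE
      (fun e => mem_edges_toFinset) (fun e he => by
        obtain ⟨h1, h2⟩ := hElog i e he
        obtain ⟨h3, h4⟩ := (hNmem e).1 (Finset.mem_filter.1 he).1
        refine ⟨h3, h4, ?_, ?_⟩
        · rw [hs]; nlinarith
        · calc 3 * (s * 2 ^ i) ≤ t * 2 ^ i := by rw [hs]; nlinarith
            _ ≤ t * w e := mul_le_mul_of_nonneg_left h1 (by linarith))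
    have hEsum : ∑ f ∈ E i, 4 * w f / (s * 2 ^ i) * W i f ≤ (E i).card * (1 / 2) := by
      rw [← nsmul_eq_mul]
      refine Finset.sum_le_card_nsmul _ _ _ fun f hf => ?_
      have h1 := (hElog i f hf).2
      rw [div_mul_eq_mul_div, div_le_iff₀ hD, hs]
      have h2 := mul_le_mul h1 (hWk i f) (hW0 i f) (by positivity)
      linarith
    have hTsum : ∑ f ∈ TE with w f ≤ s * 2 ^ i / 8, 4 * w f / (s * 2 ^ i) * W i f ≤
        ∑ f ∈ TE, 4 * w f / (s * 2 ^ i) * W i f :=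
      Finset.sum_le_sum_of_subset_of_nonneg (Finset.filter_subset _ _) fun f _ _ =>
        mul_nonneg (div_nonneg (mul_nonneg zero_le_four (hw f)) hD.le) (hW0 i f)
    simp only [hW, hh] at hEsum hTsum ⊢
    clear_value s k
    linarith only [key, hEsum, hTsum]
  have hNsum := sum_le_of_scales N TE hw hNpos hk1 hs W hWsum hscale
  have hsub : TE ⊆ HE := by
    intro e he
    rw [mem_edges_toFinset] at he ⊢
    exact SimpleGraph.edgeSet_mono hTH he
  have hsplit := Finset.sum_sdiff (f := w) hsub
  change ∑ e ∈ HE, w e ≤ 8 * ∑ e ∈ TE, w e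
  linarith

end LightSpanner

section TerminalSpanner

/-- A connected graph has a non-contracting map to an interval of twice its weight. -/
theorem exists_line_embedding {V : Type*} [Fintype V] {w : Sym2 V → ℝ} (hw : ∀ e, 0 ≤ w e)
    {T : SimpleGraph V} (hT : T.Connected) (r : V) :
    ∃ φ : V → ℝ, φ r = 0 ∧ (∀ v, 0 ≤ φ v) ∧ (∀ v, φ v ≤ 2 * wWeight T w) ∧
      ∀ u v, wdist T w u v ≤ |φ u - φ v| := by
  have main : ∀ n, n + 1 ≤ Fintype.card V → ∃ (S : Finset V) (U : Finset (Sym2 V)) (φ : V → ℝ),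
      S.card = n + 1 ∧ r ∈ S ∧ (∀ e ∈ U, e ∈ T.edgeSet ∧ ∀ x ∈ e, x ∈ S) ∧ φ r = 0 ∧
      (∀ v ∈ S, 0 ≤ φ v ∧ φ v ≤ 2 * ∑ e ∈ U, w e) ∧
      ∀ u ∈ S, ∀ v ∈ S, wdist T w u v ≤ |φ u - φ v| := by
    intro n
    induction n with
    | zero =>
      refine fun _ => ⟨{r}, ∅, fun _ => 0, by simp, by simp, by simp, rfl, by simp, ?_⟩
      intro u hu v hv
      rw [Finset.mem_singleton.1 hu, Finset.mem_singleton.1 hv, wdist_self hw]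
      simp
    | succ n ih =>
      intro hn
      obtain ⟨S, U, φ, hS, hrS, hU, hφr, hφ, hd⟩ := ih (by omega)
      obtain ⟨z, hz⟩ : ∃ z, z ∉ S := by
        by_contra! h
        have := Finset.card_eq_iff_eq_univ S |>.2 (Finset.eq_univ_of_forall h)
        omega
      obtain ⟨p⟩ := hT.preconnected r z
      obtain ⟨⟨⟨a, b⟩, hab⟩, -, ha, hb⟩ := p.exists_boundary_dart (S : Set V) hrS hz
      simp only [Finset.mem_coe] at ha hb hab
      have hwab := hw s(a, b)
      have hnotU : s(a, b) ∉ U := fun h => hb ((hU _ h).2 b (Sym2.mem_mk_right a b))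
      have hdab := wdist_le_of_adj hw hab
      have hφ' : ∀ x ∈ S, x ≠ b := fun x hx h => hb (h ▸ hx)
      have hbd : ∀ x ∈ S, wdist T w b x ≤ w s(a, b) + |φ a - φ x| := by
        intro x hx
        have t1 := wdist_triangle hw hT b a x
        rw [wdist_comm T w b a] at t1
        linarith [hd a ha x hx]
      set ψ : V → ℝ := fun x => if x = b then φ a + w s(a, b) else
        if φ x ≤ φ a then φ x else φ x + 2 * w s(a, b) with hψ
      have hψb : ψ b = φ a + w s(a, b) := by simp [hψ]
      have hψS : ∀ x ∈ S, ψ x = if φ x ≤ φ a then φ x else φ x + 2 * w s(a, b) := by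
        intro x hx
        simp only [hψ, if_neg (hφ' x hx)]
      have hbψ : ∀ x ∈ S, wdist T w b x ≤ |ψ b - ψ x| := by
        intro x hx
        refine (hbd x hx).trans ?_
        rw [hψb, hψS x hx]
        split_ifs with h
        · rw [abs_of_nonneg (by linarith), abs_of_nonneg (by linarith)]; linarith
        · rw [abs_of_nonpos (by linarith), abs_of_nonpos (by linarith)]; linarith
      refine ⟨insert b S, insert s(a, b) U, ψ, ?_, ?_, ?_, ?_, ?_, ?_⟩
      · rw [Finset.card_insert_of_notMem hb, hS]
      · exact Finset.mem_insert_of_mem hrS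
      · intro e he
        rcases Finset.mem_insert.1 he with rfl | he
        · refine ⟨hab, fun x hx => ?_⟩
          rcases Sym2.mem_iff.1 hx with rfl | rfl
          · exact Finset.mem_insert_of_mem ha
          · exact Finset.mem_insert_self _ _
        · exact ⟨(hU e he).1, fun x hx => Finset.mem_insert_of_mem ((hU e he).2 x hx)⟩
      · rw [hψS r hrS, hφr, if_pos (hφ a ha).1]
      · rw [Finset.sum_insert hnotU]
        intro v hv
        have h1 := hφ a ha
        rcases Finset.mem_insert.1 hv with rfl | hv
        · rw [hψb]; constructor <;> linarith
        · have h2 := hφ v hv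
          rw [hψS v hv]
          split_ifs <;> constructor <;> linarith
      · intro u hu v hv
        rcases Finset.mem_insert.1 hu with rfl | hu
        · rcases Finset.mem_insert.1 hv with rfl | hv
          · rw [wdist_self hw]; exact abs_nonneg _
          · exact hbψ v hv
        · rcases Finset.mem_insert.1 hv with rfl | hv
          · rw [wdist_comm, abs_sub_comm]; exact hbψ u ‹u ∈ S›
          · refine (hd u hu v hv).trans ?_
            rw [hψS u hu, hψS v hv]
            split_ifs
            · exact le_rfl
            · rw [abs_of_nonpos (by linarith), abs_of_nonpos (by linarith)]; linarith
            · rw [abs_of_nonneg (by linarith), abs_of_nonneg (by linarith)]; linarith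
            · exact le_of_eq (by congr 1; ring)
  have hcard : 0 < Fintype.card V := Fintype.card_pos_iff.2 ⟨r⟩
  obtain ⟨S, U, φ, hS, -, hU, hφr, hφ, hd⟩ := main (Fintype.card V - 1) (by omega)
  have hSuniv : S = Finset.univ := (Finset.card_eq_iff_eq_univ S).1 (by omega)
  subst hSuniv
  refine ⟨φ, hφr, fun v => (hφ v (Finset.mem_univ v)).1, fun v => ?_,
    fun u v => hd u (Finset.mem_univ u) v (Finset.mem_univ v)⟩
  refine (hφ v (Finset.mem_univ v)).2.trans ?_
  have : ∑ e ∈ U, w e ≤ wWeight T w :=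
    Finset.sum_le_sum_of_subset_of_nonneg (fun e he => mem_edges_toFinset.2 (hU e he).1)
      fun e _ _ => hw e
  linarith

theorem exists_breakpoints {V : Type*} (φ δ : V → ℝ) (hδ : ∀ v, 0 ≤ δ v) (r : V)
    (hφr : φ r = 0) (hφ : ∀ v, 0 ≤ φ v) (S : Finset V) :
    ∃ B ⊆ S, (∀ v ∈ S, ∃ b ∈ insert r B, |φ v - φ b| ≤ δ v) ∧
      ∃ b ∈ insert r B, ∑ x ∈ B, δ x ≤ φ b := by
  induction S using Finset.induction_on_max_value φ with
  | empty => exact ⟨∅, le_rfl, by simp, r, by simp, by simp [hφr]⟩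
  | insert v S hv hmax ih =>
    obtain ⟨B, hBS, hcov, b, hb, hsum⟩ := ih
    by_cases h : ∃ b ∈ insert r B, |φ v - φ b| ≤ δ v
    · refine ⟨B, hBS.trans (Finset.subset_insert v S), fun u hu => ?_, b, hb, hsum⟩
      rcases Finset.mem_insert.1 hu with rfl | hu
      · exact h
      · exact hcov u hu
    · push Not at h
      refine ⟨insert v B, Finset.insert_subset_insert v hBS, fun u hu => ?_, v, by simp, ?_⟩
      · rcases Finset.mem_insert.1 hu with rfl | hu
        · exact ⟨u, by simp, by simpa using hδ u⟩
        · obtain ⟨c, hc, hle⟩ := hcov u hu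
          exact ⟨c, Finset.insert_subset_insert r (Finset.subset_insert v B) hc, hle⟩
      · rw [Finset.sum_insert fun hvB => hv (hBS hvB)]
        have h1 := h b hb
        have h2 : φ b ≤ φ v := by
          rcases Finset.mem_insert.1 hb with rfl | hb
          · rw [hφr]; exact hφ v
          · exact hmax b (hBS hb)
        rw [abs_of_nonneg (sub_nonneg.2 h2)] at h1
        linarith

theorem wWeight_sup_edge_le {V : Type*} [Fintype V] {w : Sym2 V → ℝ} (hw : ∀ e, 0 ≤ w e)
    (H : SimpleGraph V) (a b : V) :
    wWeight (H ⊔ SimpleGraph.edge a b) w ≤ wWeight H w + w s(a, b) := by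
  have hsub : (H ⊔ SimpleGraph.edge a b).edgeSet.toFinite.toFinset ⊆
      insert s(a, b) H.edgeSet.toFinite.toFinset := by
    intro e he
    rw [mem_edges_toFinset] at he
    rw [Finset.mem_insert, mem_edges_toFinset]
    induction e using Sym2.ind with | _ x y =>
    rcases he with h | h
    · exact Or.inr h
    · rw [SimpleGraph.edge_adj] at h
      exact Or.inl (Sym2.eq_iff.2 h.1)
  refine (Finset.sum_le_sum_of_subset_of_nonneg hsub fun e _ _ => hw e).trans ?_
  by_cases h : s(a, b) ∈ H.edgeSet.toFinite.toFinset
  · rw [Finset.insert_eq_of_mem h]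
    exact le_add_of_nonneg_right (hw _)
  · rw [Finset.sum_insert h, add_comm]
    rfl

theorem exists_sup_walk {V : Type*} [Fintype V] {w : Sym2 V → ℝ} (hw : ∀ e, 0 ≤ w e)
    {G H : SimpleGraph V} (hH : H.Connected) (hHG : H ≤ G) {a b : V} (p : G.Walk a b) :
    ∃ H' : SimpleGraph V, H ≤ H' ∧ H' ≤ G ∧ wWeight H' w ≤ wWeight H w + wlen w p ∧
      wdist H' w a b ≤ wlen w p := by
  induction p with
  | nil => exact ⟨H, le_rfl, hHG, by simp, by simp [wdist_self hw]⟩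
  | @cons u v x h p ih =>
    obtain ⟨H', hHH', hH'G, hwt, hdist⟩ := ih
    have hle : H' ≤ H' ⊔ SimpleGraph.edge u v := le_sup_left
    have hH' := hH.mono hHH'
    refine ⟨H' ⊔ SimpleGraph.edge u v, hHH'.trans hle, sup_le hH'G ?_, ?_, ?_⟩
    · exact (SimpleGraph.edge_le_iff _).2 (Or.inr h)
    · have := wWeight_sup_edge_le hw H' u v
      rw [wlen_cons]
      linarith
    · have h1 : (H' ⊔ SimpleGraph.edge u v).Adj u v :=
        Or.inr ((SimpleGraph.edge_adj u v u v).2 ⟨Or.inl ⟨rfl, rfl⟩, h.ne⟩)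
      have h2 := wdist_le_of_adj hw h1
      have h3 := wdist_anti hw hle hH' v x
      have h4 := wdist_triangle hw (hH'.mono hle) u v x
      rw [wlen_cons]
      linarith

/-- Adding shortest paths between prescribed pairs of vertices. -/
theorem exists_sup_shortest_paths {V ι : Type*} [Fintype V] {w : Sym2 V → ℝ}
    (hw : ∀ e, 0 ≤ w e) {G T : SimpleGraph V} (hT : T.Connected) (hTG : T ≤ G) (J : Finset ι)
    (a b : ι → V) :
    ∃ H : SimpleGraph V, T ≤ H ∧ H ≤ G ∧
      wWeight H w ≤ wWeight T w + ∑ j ∈ J, wdist G w (a j) (b j) ∧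
      ∀ j ∈ J, wdist H w (a j) (b j) ≤ wdist G w (a j) (b j) := by
  induction J using Finset.induction_on with
  | empty => exact ⟨T, le_rfl, hTG, by simp, by simp⟩
  | insert i J hi ih =>
    obtain ⟨H, hTH, hHG, hwt, hd⟩ := ih
    have hH := hT.mono hTH
    obtain ⟨p, hp⟩ := exists_wlen_eq_wdist hw ((hT.mono hTG).preconnected (a i) (b i))
    obtain ⟨H', hHH', hH'G, hwt', hd'⟩ := exists_sup_walk hw hH hHG p
    rw [hp] at hwt' hd'
    refine ⟨H', hTH.trans hHH', hH'G, ?_, fun j hj => ?_⟩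
    · rw [Finset.sum_insert hi]
      linarith
    · rcases Finset.mem_insert.1 hj with rfl | hj
      · exact hd'
      · exact (wdist_anti hw hHH' hH _ _).trans (hd j hj)

theorem wWeight_pathGraph_le {n : ℕ} {w : Sym2 (Fin (n + 1)) → ℝ} (hw : ∀ e, 0 ≤ w e) :
    wWeight (SimpleGraph.pathGraph (n + 1)) w ≤ ∑ i : Fin n, w s(i.castSucc, i.succ) := by
  have hsub : (SimpleGraph.pathGraph (n + 1)).edgeSet.toFinite.toFinset ⊆
      Finset.univ.image fun i : Fin n => s(i.castSucc, i.succ) := by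
    intro e he
    rw [mem_edges_toFinset] at he
    induction e using Sym2.ind with | _ x y =>
    rw [SimpleGraph.mem_edgeSet, SimpleGraph.pathGraph_adj] at he
    rw [Finset.mem_image]
    rcases he with h | h
    · refine ⟨⟨x, by omega⟩, Finset.mem_univ _, Sym2.eq_iff.2 (Or.inl ⟨rfl, ?_⟩)⟩
      ext; simpa using h
    · refine ⟨⟨y, by omega⟩, Finset.mem_univ _, Sym2.eq_iff.2 (Or.inr ⟨rfl, ?_⟩)⟩
      ext; simpa using h
  refine (Finset.sum_le_sum_of_subset_of_nonneg hsub fun e _ _ => hw e).trans (le_of_eq ?_)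
  refine Finset.sum_image fun i _ j _ hij => ?_
  rcases Sym2.eq_iff.1 hij with ⟨h, -⟩ | ⟨h1, h2⟩
  · exact Fin.castSucc_injective _ h
  · simp only [Fin.ext_iff, Fin.val_castSucc, Fin.val_succ] at h1 h2
    omega

theorem exists_monotone_enum {V : Type*} (K : Finset V) (φ : V → ℝ) {n : ℕ}
    (hn : K.card = n) : ∃ x : Fin n → V, Function.Injective x ∧
      (∀ v, v ∈ K ↔ ∃ i, x i = v) ∧ Monotone (φ ∘ x) := by
  subst hn
  set e := K.equivFin.symm with he
  set σ := Tuple.sort fun i => φ (e i) with hσ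
  refine ⟨fun i => e (σ i), fun i j hij => σ.injective (e.injective (Subtype.ext hij)),
    fun v => ⟨fun hv => ⟨σ.symm (e.symm ⟨v, hv⟩), by simp⟩, ?_⟩, Tuple.monotone_sort fun i => φ (e i)⟩
  rintro ⟨i, rfl⟩
  exact (e (σ i)).2

/-- A light subgraph preserving distances between terminals up to a logarithmic factor. -/
theorem exists_sup_terminals {V : Type*} [Fintype V] {w : Sym2 V → ℝ} (hw : ∀ e, 0 ≤ w e)
    {G T : SimpleGraph V} (hpos : ∀ e ∈ G.edgeSet, 0 < w e) (hT : T.Connected) (hTG : T ≤ G)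
    {K : Finset V} (hK : K.Nonempty) :
    ∃ H : SimpleGraph V, T ≤ H ∧ H ≤ G ∧ wWeight H w ≤ 17 * wWeight T w ∧
      ∀ u ∈ K, ∀ v ∈ K, wdist H w u v ≤ 48 * (harmonic K.card : ℝ) * wdist G w u v := by
  have hG := hT.mono hTG
  obtain ⟨n, hn⟩ := Nat.exists_eq_succ_of_ne_zero (Finset.card_pos.2 hK).ne'
  obtain ⟨φ, -, hφ0, hφL, hφ⟩ := exists_line_embedding hw hT hK.choose
  obtain ⟨x, hxinj, hxK, hxmono⟩ := exists_monotone_enum K φ hn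
  set w' : Sym2 (Fin (n + 1)) → ℝ :=
    Sym2.lift ⟨fun i j => wdist G w (x i) (x j), fun i j => wdist_comm G w _ _⟩ with hw'def
  have hw'mk : ∀ i j, w' s(i, j) = wdist G w (x i) (x j) := fun i j => rfl
  have hw' : ∀ e, 0 ≤ w' e := by
    intro e
    induction e using Sym2.ind with | _ i j => exact wdist_nonneg hw _ _ _
  obtain ⟨T', hT'le, hT'⟩ := (SimpleGraph.pathGraph_connected n).exists_isTree_le
  have hT'wt : wWeight T' w' ≤ 2 * wWeight T w := by
    calc wWeight T' w' ≤ wWeight (SimpleGraph.pathGraph (n + 1)) w' :=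
          Finset.sum_le_sum_of_subset_of_nonneg (fun e he => by
            rw [mem_edges_toFinset] at he ⊢
            exact SimpleGraph.edgeSet_mono hT'le he) fun e _ _ => hw' e
      _ ≤ ∑ i : Fin n, w' s(i.castSucc, i.succ) := wWeight_pathGraph_le hw'
      _ ≤ ∑ i : Fin n, (φ (x i.succ) - φ (x i.castSucc)) := by
          refine Finset.sum_le_sum fun i _ => ?_
          have h1 := hφ (x i.castSucc) (x i.succ)
          have h2 : φ (x i.castSucc) ≤ φ (x i.succ) := hxmono (Fin.castSucc_lt_succ).le
          rw [abs_sub_comm, abs_of_nonneg (sub_nonneg.2 h2)] at h1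
          exact (wdist_anti hw hTG hT _ _).trans h1
      _ = φ (x (Fin.last n)) - φ (x 0) := by
          rw [Finset.sum_sub_distrib]
          have h1 := Fin.sum_univ_succ fun i => φ (x i)
          have h2 := Fin.sum_univ_castSucc fun i => φ (x i)
          linarith
      _ ≤ 2 * wWeight T w := by
          have := hφ0 (x 0)
          have := hφL (x (Fin.last n))
          linarith
  obtain ⟨H', hT'H', -, hH'wt, hH'⟩ := exists_light_spanner hw' (G := ⊤) (T := T') (by
      intro e he
      induction e using Sym2.ind with | _ i j =>
      rw [SimpleGraph.mem_edgeSet, SimpleGraph.top_adj] at he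
      exact wdist_pos hw hpos hG (hxinj.ne he)) hT' le_top le_rfl
  have hout : ∀ f : Sym2 (Fin (n + 1)), s((Quot.out f).1, (Quot.out f).2) = f :=
    fun f => Quot.out_eq f
  obtain ⟨H, hTH, hHG, hHwt, hHd⟩ := exists_sup_shortest_paths hw hT hTG
    H'.edgeSet.toFinite.toFinset (fun e => x (Quot.out e).1) (fun e => x (Quot.out e).2)
  have hH := hT.mono hTH
  have hsum : ∑ e ∈ H'.edgeSet.toFinite.toFinset,
      wdist G w (x (Quot.out e).1) (x (Quot.out e).2) = wWeight H' w' := by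
    refine Finset.sum_congr rfl fun e _ => ?_
    rw [← hw'mk, hout]
  rw [hsum] at hHwt
  refine ⟨H, hTH, hHG, by linarith, ?_⟩
  have hadj : ∀ i j, H'.Adj i j → wdist H w (x i) (x j) ≤ w' s(i, j) := by
    intro i j hij
    have h1 := hHd s(i, j) (mem_edges_toFinset.2 hij)
    rw [hw'mk]
    rcases Sym2.eq_iff.1 (hout s(i, j)) with ⟨h2, h3⟩ | ⟨h2, h3⟩
    · rwa [h2, h3] at h1
    · rw [h2, h3, wdist_comm H, wdist_comm G] at h1
      exact h1
  have hwalk : ∀ i j (p : H'.Walk i j), wdist H w (x i) (x j) ≤ wlen w' p := by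
    intro i j p
    induction p with
    | nil => simp [wdist_self hw]
    | cons h p ih =>
      rw [wlen_cons]
      exact (wdist_triangle hw hH _ _ _).trans (add_le_add (hadj _ _ h) ih)
  intro u hu v hv
  obtain ⟨i, rfl⟩ := (hxK u).1 hu
  obtain ⟨j, rfl⟩ := (hxK v).1 hv
  by_cases hij : i = j
  · rw [hij, wdist_self hw, wdist_self hw, mul_zero]
  · obtain ⟨p, hp⟩ := exists_wlen_eq_wdist hw' ((hT'.connected.mono hT'H').preconnected i j)
    have h1 := hH' i j hij
    rw [Fintype.card_fin, hw'mk] at h1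
    rw [hn]
    exact ((hwalk i j p).trans hp.le).trans h1

/-- Terminal spanner above a given spanning tree. -/
theorem exists_terminal_spanner {V : Type*} [Fintype V] {w : Sym2 V → ℝ} (hw : ∀ e, 0 ≤ w e)
    {G T : SimpleGraph V} (hpos : ∀ e ∈ G.edgeSet, 0 < w e) (hT : T.Connected) (hTG : T ≤ G)
    {K : Finset V} (hK : K.Nonempty) :
    ∃ H : SimpleGraph V, T ≤ H ∧ H ≤ G ∧ wWeight H w ≤ 19 * wWeight T w ∧
      ∀ u ∈ K, ∀ v, wdist H w u v ≤ (192 * (harmonic K.card : ℝ) + 3) * wdist G w u v := by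
  have hG := hT.mono hTG
  obtain ⟨H₁, hTH₁, hH₁G, hH₁wt, hH₁⟩ := exists_sup_terminals hw hpos hT hTG hK
  have hnear : ∀ v, ∃ κ ∈ K, ∀ κ' ∈ K, wdist G w v κ ≤ wdist G w v κ' :=
    fun v => K.exists_min_image _ hK
  choose near hnearK hnear using hnear
  obtain ⟨r, hr⟩ := hK
  obtain ⟨φ, hφr, hφ0, hφL, hφ⟩ := exists_line_embedding hw hT r
  obtain ⟨B, -, hcov, b₀, -, hB⟩ := exists_breakpoints φ (fun v => wdist G w v (near v))
    (fun v => wdist_nonneg hw _ _ _) r hφr hφ0 Finset.univ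
  obtain ⟨H, hH₁H, hHG, hHwt, hHd⟩ :=
    exists_sup_shortest_paths hw (hT.mono hTH₁) hH₁G B id near
  have hTH := hTH₁.trans hH₁H
  have hH := hT.mono hTH
  simp only [id] at hHwt hHd
  refine ⟨H, hTH, hHG, by linarith [hφL b₀], ?_⟩
  have hclose : ∀ v, ∃ κ ∈ K, wdist H w v κ ≤ 3 * wdist G w v (near v) := by
    intro v
    obtain ⟨b, hb, hvb⟩ := hcov v (Finset.mem_univ v)
    have hT1 := (hφ v b).trans hvb
    have h0 := wdist_nonneg hw G v (near v)
    have h1 := wdist_anti hw hTH hT v b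
    rcases Finset.mem_insert.1 hb with rfl | hb
    · exact ⟨b, hr, by linarith⟩
    · refine ⟨near b, hnearK b, ?_⟩
      have h2 := hHd b hb
      have h3 := hnear b (near v) (hnearK v)
      have h4 := wdist_triangle hw hG b v (near v)
      have h5 := wdist_anti hw hTG hT b v
      rw [wdist_comm T w b v] at h5
      have h6 := wdist_triangle hw hH v b (near b)
      linarith
  intro u hu v
  obtain ⟨κ, hκ, hκd⟩ := hclose v
  have h1 := (wdist_anti hw hH₁H (hT.mono hTH₁) u κ).trans (hH₁ u hu κ hκ)
  have h2 := wdist_triangle hw hH u κ v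
  have h3 := wdist_triangle hw hG u v κ
  have h4 := wdist_anti hw hHG hH v κ
  have h5 := hnear v u hu
  rw [wdist_comm G w v u] at h5
  rw [wdist_comm H w κ v] at h2
  have h6 : wdist G w u κ ≤ 4 * wdist G w u v := by linarith
  have h7 : (0 : ℝ) ≤ 48 * (harmonic K.card : ℝ) := by
    have : (0 : ℚ) ≤ harmonic K.card := Finset.sum_nonneg fun i _ => by positivity
    exact mul_nonneg (by norm_num) (by exact_mod_cast this)
  have h8 := mul_le_mul_of_nonneg_left h6 h7
  linarith

end TerminalSpanner

theorem wdist_congr {V : Type*} {G : SimpleGraph V} {w w' : Sym2 V → ℝ}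
    (h : ∀ e ∈ G.edgeSet, w e = w' e) (u v : V) : wdist G w u v = wdist G w' u v := by
  unfold wdist
  congr! 5 with x p
  rw [List.map_congr_left fun e he => h e (p.edges_subset_edgeSet he)]

theorem wWeight_congr {V : Type*} [Fintype V] {G : SimpleGraph V} {w w' : Sym2 V → ℝ}
    (h : ∀ e ∈ G.edgeSet, w e = w' e) : wWeight G w = wWeight G w' :=
  Finset.sum_congr rfl fun e he => h e (mem_edges_toFinset.1 he)

theorem exists_isMST {V : Type*} [Fintype V] {G : SimpleGraph V} (hG : G.Connected)
    (w : Sym2 V → ℝ) : ∃ T, IsMST G w T := by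
  obtain ⟨T₀, hT₀⟩ := hG.exists_isTree_le
  obtain ⟨T, hT, hmin⟩ := Set.exists_min_image {T | IsSpanningTree G T} (fun T => wWeight T w)
    (Set.toFinite _) ⟨T₀, hT₀⟩
  exact ⟨T, hT, hmin⟩

theorem IsMST.mstWeight_eq {V : Type*} [Fintype V] {G T : SimpleGraph V} {w : Sym2 V → ℝ}
    (h : IsMST G w T) : mstWeight G w = wWeight T w :=
  IsLeast.csInf_eq ⟨⟨T, h.1, rfl⟩, by rintro x ⟨T', hT', rfl⟩; exact h.2 T' hT'⟩

theorem harmonic_le_two_mul_logb {k : ℕ} (hk : 2 ≤ k) :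
    (harmonic k : ℝ) ≤ 2 * Real.logb 2 k ∧ 1 ≤ Real.logb 2 k := by
  have hk' : (2 : ℝ) ≤ k := by exact_mod_cast hk
  have h1 : 1 ≤ Real.logb 2 k := by
    rw [Real.le_logb_iff_rpow_le one_lt_two (by linarith)]
    simpa using hk'
  refine ⟨?_, h1⟩
  have h2 := harmonic_le_one_add_log k
  have h3 : Real.log k = Real.logb 2 k * Real.log 2 := by
    rw [Real.logb, div_mul_cancel₀ _ (Real.log_pos one_lt_two).ne']
  have h4 : Real.log 2 ≤ 1 := by linarith [Real.log_two_lt_d9]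
  nlinarith

/-- There is a universal constant `C > 0` such that for every weighted
graph `G` and every subset `K ⊆ V` with `|K| = k ≥ 2`, there is a spanner `H` containing
the MST of `G`, of lightness at most `C`, in which every pair in `K × V` has distortion
at most `C·log₂(k)`. -/
theorem stmt15 :
    ∃ C : ℝ, 0 < C ∧
      ∀ (V : Type) [Fintype V] (G : SimpleGraph V) (w : Sym2 V → ℝ),
        IsWeightedGraph G w →
        ∀ K : Finset V, 2 ≤ K.card →
          ∃ H : SimpleGraph V, IsSpanner G H ∧
            (∃ T : SimpleGraph V, IsMST G w T ∧ T ≤ H) ∧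
            wWeight H w / mstWeight G w ≤ C ∧
            ∀ u ∈ K, ∀ v : V,
              wdist H w u v ≤ (C * Real.logb 2 (K.card : ℝ)) * wdist G w u v := by
  refine ⟨400, by norm_num, fun V _ G w ⟨hG, hpos, _⟩ K hK => ?_⟩
  obtain ⟨T, hT⟩ := exists_isMST hG w
  have habs : ∀ H ≤ G, ∀ e ∈ H.edgeSet, w e = |w e| := fun H hH e he =>
    (abs_of_pos (hpos e (SimpleGraph.edgeSet_mono hH he))).symm
  obtain ⟨H, hTH, hHG, hwt, hd⟩ := exists_terminal_spanner (w := fun e => |w e|)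
    (fun e => abs_nonneg _) (fun e he => abs_pos.2 (hpos e he).ne') hT.1.2.connected hT.1.1
    (Finset.card_pos.1 (by omega : 0 < K.card))
  rw [← wWeight_congr (habs H hHG), ← wWeight_congr (habs T hT.1.1)] at hwt
  have hT0 : 0 ≤ wWeight T w := Finset.sum_nonneg fun e he =>
    (hpos e (SimpleGraph.edgeSet_mono hT.1.1 (mem_edges_toFinset.1 he))).le
  refine ⟨H, ⟨hHG, hT.1.2.connected.mono hTH⟩, ⟨T, hT, hTH⟩, ?_, fun u hu v => ?_⟩
  · rw [hT.mstWeight_eq]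
    exact div_le_of_le_mul₀ hT0 (by norm_num) (by linarith)
  · rw [wdist_congr (habs H hHG), wdist_congr (habs G le_rfl)]
    refine (hd u hu v).trans (mul_le_mul_of_nonneg_right ?_ (wdist_nonneg (fun e => abs_nonneg _)
      _ _ _))
    obtain ⟨h1, h2⟩ := harmonic_le_two_mul_logb hK
    linarith
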